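/- Let f(x) = (1 − x)^α g(x) or f(x) = (1 + x)^α g(x), where α > 0 is not an integer and g is infinitely differentiable on [−1,1]. Then the error of the (n+1)-point Clenshaw–Curtis quadrature rule applied to ∫_{−1}^{1} f(x) dx satisfies E_n^C[f] = O(n^{−2α−2}) as n → ∞. -/

import Mathlib

open Real Filter Finset

/-- The Chebyshev coefficients of `f : [-1,1] → ℝ`:
`a_k = (2/π) ∫_0^π f(cos t) cos(kt) dt`. -/
noncomputable def chebCoeff (f : ℝ → ℝ) (k : ℕ) : ℝ :=
  (2 / π) * ∫ t in (0 : ℝ)..π, f (Real.cos t) * Real.cos ((k : ℝ) * t)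

/-- `δ_j = 1/2` if `j = 0` or `j = n`, and `δ_j = 1` otherwise. -/
noncomputable def ccDelta (n j : ℕ) : ℝ := if j = 0 ∨ j = n then 1 / 2 else 1

/-- The Clenshaw–Curtis quadrature weights
`w_j = (4δ_j/n) Σ_{k=0}^{⌊n/2⌋} δ_{2k} cos(2jkπ/n)/(1−4k²)`. -/
noncomputable def ccWeight (n j : ℕ) : ℝ :=
  (4 * ccDelta n j / (n : ℝ)) * ∑ k ∈ Finset.range (n / 2 + 1),
    ccDelta n (2 * k) * Real.cos (2 * (j : ℝ) * (k : ℝ) * π / (n : ℝ)) / (1 - 4 * (k : ℝ) ^ 2)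

/-- The `(n+1)`-point Clenshaw–Curtis quadrature rule
`I_n^C[f] = Σ_{j=0}^{n} w_j f(cos(jπ/n))`. -/
noncomputable def ccQuad (f : ℝ → ℝ) (n : ℕ) : ℝ :=
  ∑ j ∈ Finset.range (n + 1), ccWeight n j * f (Real.cos ((j : ℝ) * π / (n : ℝ)))

/-- The Clenshaw–Curtis quadrature error `E_n^C[f] = ∫_{-1}^1 f − I_n^C[f]`. -/
noncomputable def ccError (f : ℝ → ℝ) (n : ℕ) : ℝ :=
  (∫ x in (-1 : ℝ)..1, f x) - ccQuad f n

lemma one_sub_cos_rpow_le (β : ℝ) :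
    ∃ C, 0 ≤ C ∧ ∀ t, 0 < t → t ≤ π → (1 - cos t) ^ β ≤ C * t ^ (2 * β) := by
  rcases le_total 0 β with hβ | hβ
  · refine ⟨1, zero_le_one, fun t ht _ => ?_⟩
    rw [one_mul, Real.rpow_mul ht.le, Real.rpow_two]
    refine Real.rpow_le_rpow (by linarith [Real.cos_le_one t]) ?_ hβ
    nlinarith [Real.one_sub_sq_div_two_le_cos (x := t)]
  · refine ⟨(2 / π ^ 2) ^ β, by positivity, fun t ht htπ => ?_⟩
    rw [Real.rpow_mul ht.le, Real.rpow_two, ← Real.mul_rpow (by positivity) (by positivity)]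
    refine Real.rpow_le_rpow_of_nonpos (by positivity) ?_ hβ
    linarith [Real.cos_le_one_sub_mul_cos_sq (x := t) (by rwa [abs_of_pos ht])]

lemma one_sub_cos_pos {t : ℝ} (ht : 0 < t) (htπ : t ≤ π) : 0 < 1 - cos t := by
  have := Real.cos_lt_cos_of_nonneg_of_le_pi le_rfl htπ ht
  rw [Real.cos_zero] at this
  linarith

lemma cos_mem_Icc' (t : ℝ) : cos t ∈ Set.Icc (-1 : ℝ) 1 := ⟨Real.neg_one_le_cos t, Real.cos_le_one t⟩

lemma continuous_comp_cos {h : ℝ → ℝ} (hh : ContinuousOn h (Set.Icc (-1) 1)) :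
    Continuous fun t => h (cos t) :=
  hh.comp_continuous Real.continuous_cos cos_mem_Icc'

lemma continuousOn_one_sub_cos_rpow_mul (β : ℝ) {h : ℝ → ℝ} (hh : ContinuousOn h (Set.Icc (-1) 1))
    {ε : ℝ} (hε : 0 < ε) :
    ContinuousOn (fun t => (1 - cos t) ^ β * h (cos t)) (Set.Icc ε π) := by
  refine ContinuousOn.mul (ContinuousOn.rpow_const (by fun_prop) fun t ht => Or.inl ?_)
    (continuous_comp_cos hh).continuousOn
  exact (one_sub_cos_pos (hε.trans_le ht.1) ht.2).ne'

lemma hasDerivAt_one_sub_cos_rpow_mul (β : ℝ) {h : ℝ → ℝ} {h' t : ℝ} (ht : 0 < t) (htπ : t ≤ π)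
    (hd : HasDerivAt h h' (cos t)) :
    HasDerivAt (fun t => (1 - cos t) ^ β * h (cos t))
      (-(sin t * ((1 - cos t) ^ (β - 1) * ((1 - cos t) * h' - β * h (cos t))))) t := by
  have hpos := one_sub_cos_pos ht htπ
  have h1 : HasDerivAt (fun t => 1 - cos t) (sin t) t := by
    simpa using (Real.hasDerivAt_cos t).const_sub 1
  have h2 := (h1.rpow_const (p := β) (Or.inl hpos.ne')).mul (hd.comp t (Real.hasDerivAt_cos t))
  refine h2.congr_deriv ?_
  have h3 : (1 - cos t) ^ β = (1 - cos t) ^ (β - 1) * (1 - cos t) := by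
    rw [← Real.rpow_add_one hpos.ne']; ring_nf
  simp only [Function.comp_apply]
  rw [h3]
  ring

lemma hasDerivAt_derivWithin_of_contDiffOn {h : ℝ → ℝ}
    (hh : ContDiffOn ℝ (⊤ : ℕ∞) h (Set.Icc (-1) 1)) {t : ℝ} (ht : 0 < t) (htπ : t < π) :
    HasDerivAt h (derivWithin h (Set.Icc (-1) 1) (cos t)) (cos t) := by
  have h1 : cos t < 1 := by linarith [one_sub_cos_pos ht htπ.le]
  have h2 : -1 < cos t := by
    have := Real.cos_lt_cos_of_nonneg_of_le_pi ht.le le_rfl htπ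
    rwa [Real.cos_pi] at this
  exact ((hh.differentiableOn (by simp)) _ (cos_mem_Icc' t)).hasDerivWithinAt.hasDerivAt
    (Icc_mem_nhds h2 h1)

/-- The operator `h ↦ u` with `((1-x)^β h)' = (1-x)^(β-1) u`. -/
noncomputable def jacobiDeriv (β : ℝ) (h : ℝ → ℝ) (x : ℝ) : ℝ :=
  (1 - x) * derivWithin h (Set.Icc (-1) 1) x - β * h x

lemma ContDiffOn.jacobiDeriv (β : ℝ) {h : ℝ → ℝ}
    (hh : ContDiffOn ℝ (⊤ : ℕ∞) h (Set.Icc (-1) 1)) :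
    ContDiffOn ℝ (⊤ : ℕ∞) (jacobiDeriv β h) (Set.Icc (-1) 1) := by
  have h1 : ContDiffOn ℝ (⊤ : ℕ∞) (derivWithin h (Set.Icc (-1) 1)) (Set.Icc (-1) 1) :=
    hh.derivWithin (uniqueDiffOn_Icc (by norm_num)) (by simp)
  exact ((contDiffOn_const.sub contDiffOn_id).mul h1).sub (contDiffOn_const.mul hh)

/-- The operator `h ↦ H` with
`d²/dt² ((1 - cos t)^β h(cos t)) = (1 - cos t)^(β-1) H(cos t)`. -/
noncomputable def jacobiDeriv₂ (β : ℝ) (h : ℝ → ℝ) (x : ℝ) : ℝ :=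
  (1 + x) * jacobiDeriv (β - 1) (jacobiDeriv β h) x - x * jacobiDeriv β h x

lemma ContDiffOn.jacobiDeriv₂ (β : ℝ) {h : ℝ → ℝ}
    (hh : ContDiffOn ℝ (⊤ : ℕ∞) h (Set.Icc (-1) 1)) :
    ContDiffOn ℝ (⊤ : ℕ∞) (jacobiDeriv₂ β h) (Set.Icc (-1) 1) :=
  ((contDiffOn_const.add contDiffOn_id).mul (hh.jacobiDeriv β |>.jacobiDeriv (β - 1))).sub
    (contDiffOn_id.mul (hh.jacobiDeriv β))

lemma integral_one_sub_cos_rpow_mul_cos (β : ℝ) {h : ℝ → ℝ}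
    (hh : ContDiffOn ℝ (⊤ : ℕ∞) h (Set.Icc (-1) 1)) {ε : ℝ} (hε : 0 < ε) (hεπ : ε ≤ π)
    {k : ℕ} (hk : 1 ≤ k) :
    ∫ t in ε..π, (1 - cos t) ^ β * h (cos t) * cos (k * t) =
      -((1 - cos ε) ^ β * h (cos ε) * sin (k * ε) / k)
      + sin ε * ((1 - cos ε) ^ (β - 1) * jacobiDeriv β h (cos ε)) * cos (k * ε) / k ^ 2
      - (∫ t in ε..π, (1 - cos t) ^ (β - 1) * jacobiDeriv₂ β h (cos t) * cos (k * t)) / k ^ 2 := by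
  have hk0 : (k : ℝ) ≠ 0 := by positivity
  have hu := hh.jacobiDeriv β
  have hH := hh.jacobiDeriv₂ β
  have c0 := continuousOn_one_sub_cos_rpow_mul β hh.continuousOn hε
  have c1 := continuousOn_one_sub_cos_rpow_mul (β - 1) hu.continuousOn hε
  have c2 := continuousOn_one_sub_cos_rpow_mul (β - 1) hH.continuousOn hε
  have hcos : ContinuousOn (fun t : ℝ => cos (k * t)) (Set.Icc ε π) := by fun_prop
  have hsin : ContinuousOn (fun t : ℝ => sin (k * t)) (Set.Icc ε π) := by fun_prop
  have i0 : IntervalIntegrable (fun t => (1 - cos t) ^ β * h (cos t) * cos (k * t))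
      MeasureTheory.volume ε π := (c0.mul hcos).intervalIntegrable_of_Icc hεπ
  have i2 : IntervalIntegrable (fun t => (1 - cos t) ^ (β - 1) * jacobiDeriv₂ β h (cos t)
      * cos (k * t) / k ^ 2) MeasureTheory.volume ε π :=
    ((c2.mul hcos).intervalIntegrable_of_Icc hεπ).div_const _
  have key := intervalIntegral.integral_eq_sub_of_hasDerivAt_of_le hεπ
    (f := fun t => (1 - cos t) ^ β * h (cos t) * sin (k * t) / k
      - sin t * ((1 - cos t) ^ (β - 1) * jacobiDeriv β h (cos t)) * cos (k * t) / k ^ 2)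
    (f' := fun t => (1 - cos t) ^ β * h (cos t) * cos (k * t) +
      (1 - cos t) ^ (β - 1) * jacobiDeriv₂ β h (cos t) * cos (k * t) / k ^ 2)
    (((c0.mul hsin).div_const _).sub
      (((Real.continuous_sin.continuousOn.mul c1).mul hcos).div_const _))
    (fun t ht => ?_) (i0.add i2)
  · rw [intervalIntegral.integral_add i0 i2, intervalIntegral.integral_div] at key
    simp only [Real.sin_pi, Real.sin_nat_mul_pi] at key
    linear_combination key
  · have ht0 : 0 < t := hε.trans ht.1
    have d0 := hasDerivAt_one_sub_cos_rpow_mul β ht0 ht.2.le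
      (hasDerivAt_derivWithin_of_contDiffOn hh ht0 ht.2)
    have d1 := hasDerivAt_one_sub_cos_rpow_mul (β - 1) ht0 ht.2.le
      (hasDerivAt_derivWithin_of_contDiffOn hu ht0 ht.2)
    have hkt : HasDerivAt (fun t : ℝ => (k : ℝ) * t) k t := by
      simpa using (hasDerivAt_id t).const_mul (k : ℝ)
    have ds : HasDerivAt (fun t : ℝ => sin (k * t)) (cos (k * t) * k) t := hkt.sin
    have dc : HasDerivAt (fun t : ℝ => cos (k * t)) (-sin (k * t) * k) t := hkt.cos
    refine (((d0.mul ds).div_const (k : ℝ)).sub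
      ((((Real.hasDerivAt_sin t).mul d1).mul dc).div_const ((k : ℝ) ^ 2))).congr_deriv ?_
    have hpos := one_sub_cos_pos ht0 ht.2.le
    have h3 : (1 - cos t) ^ (β - 1) = (1 - cos t) ^ (β - 1 - 1) * (1 - cos t) := by
      rw [← Real.rpow_add_one hpos.ne']; ring_nf
    have hs : sin t ^ 2 = (1 - cos t) * (1 + cos t) := by
      rw [Real.sin_sq]; ring
    simp only [jacobiDeriv₂, Pi.mul_apply]
    rw [show (1 - cos t) * derivWithin h (Set.Icc (-1) 1) (cos t) - β * h (cos t)
      = jacobiDeriv β h (cos t) from rfl,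
      show (1 - cos t) * derivWithin (jacobiDeriv β h) (Set.Icc (-1) 1) (cos t)
        - (β - 1) * jacobiDeriv β h (cos t) = jacobiDeriv (β - 1) (jacobiDeriv β h) (cos t)
        from rfl, h3]
    field_simp
    linear_combination ((1 - cos t) ^ (β - 1 - 1) * cos (k * t) *
      jacobiDeriv (β - 1) (jacobiDeriv β h) (cos t)) * hs

lemma exists_abs_comp_cos_le {h : ℝ → ℝ} (hh : ContinuousOn h (Set.Icc (-1) 1)) :
    ∃ M, 0 ≤ M ∧ ∀ t, |h (cos t)| ≤ M := by
  obtain ⟨M, hM⟩ := isCompact_Icc.exists_bound_of_continuousOn hh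
  exact ⟨M, (norm_nonneg _).trans (hM _ (cos_mem_Icc' 0)), fun t => hM _ (cos_mem_Icc' t)⟩

lemma exists_abs_one_sub_cos_rpow_mul_le (β : ℝ) {h : ℝ → ℝ}
    (hh : ContinuousOn h (Set.Icc (-1) 1)) :
    ∃ C, 0 ≤ C ∧ ∀ t, 0 < t → t ≤ π → |(1 - cos t) ^ β * h (cos t)| ≤ C * t ^ (2 * β) := by
  obtain ⟨M, hM0, hM⟩ := exists_abs_comp_cos_le hh
  obtain ⟨C, hC0, hC⟩ := one_sub_cos_rpow_le β
  refine ⟨C * M, by positivity, fun t ht htπ => ?_⟩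
  have hp := one_sub_cos_pos ht htπ
  rw [abs_mul, abs_of_nonneg (by positivity)]
  calc _ ≤ C * t ^ (2 * β) * M := by gcongr; exacts [hC t ht htπ, hM t]
    _ = _ := by ring

lemma abs_mul_cos_le (a b : ℝ) : |a * cos b| ≤ |a| := by
  rw [abs_mul]
  exact mul_le_of_le_one_right (abs_nonneg _) (Real.abs_cos_le_one _)

lemma exists_abs_integral_one_div_pi_le (N : ℕ) : ∀ β : ℝ, β < N - 1 / 2 → ∀ h : ℝ → ℝ,
    ContDiffOn ℝ (⊤ : ℕ∞) h (Set.Icc (-1) 1) → ∃ C, ∀ k : ℕ, 1 ≤ k →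
      |∫ t in (1 / k : ℝ)..π, (1 - cos t) ^ β * h (cos t) * cos (k * t)|
        ≤ C * (k : ℝ) ^ (-2 * β - 1) := by
  induction N with
  | zero =>
    intro β hβ h hh
    simp only [Nat.cast_zero, zero_sub] at hβ
    obtain ⟨C, hC0, hC⟩ := exists_abs_one_sub_cos_rpow_mul_le β hh.continuousOn
    refine ⟨C / (-2 * β - 1), fun k hk => ?_⟩
    have hk0 : (0 : ℝ) < 1 / k := by positivity
    have hk1 : (1 / k : ℝ) ≤ π := by
      have : (1 / k : ℝ) ≤ 1 := by
        rw [div_le_one (by positivity)]; exact_mod_cast hk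
      linarith [Real.pi_gt_three]
    have h0 : (0 : ℝ) ∉ Set.uIcc (1 / k : ℝ) π := by
      rw [Set.uIcc_of_le hk1]; exact fun h => absurd h.1 (not_le.2 hk0)
    have hi : IntervalIntegrable (fun t : ℝ => C * t ^ (2 * β)) MeasureTheory.volume (1 / k) π :=
      (intervalIntegral.intervalIntegrable_rpow (Or.inr h0)).const_mul _
    rw [← Real.norm_eq_abs]
    refine (intervalIntegral.norm_integral_le_of_norm_le hk1
      (Filter.Eventually.of_forall fun t ht => ?_) hi).trans ?_
    · exact (abs_mul_cos_le _ _).trans (hC t (hk0.trans ht.1) ht.2)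
    · rw [intervalIntegral.integral_const_mul, integral_rpow (Or.inr ⟨by linarith, h0⟩),
        ← mul_div_assoc]
      have e1 : (1 / k : ℝ) ^ (2 * β + 1) = (k : ℝ) ^ (-2 * β - 1) := by
        rw [one_div, Real.inv_rpow (by positivity), ← Real.rpow_neg (by positivity)]
        ring_nf
      have hpos : 0 < -2 * β - 1 := by linarith
      have hP : 0 ≤ π ^ (2 * β + 1) := by positivity
      rw [e1, ← neg_div_neg_eq, show -(2 * β + 1) = -2 * β - 1 by ring,
        div_mul_eq_mul_div]
      gcongr
      nlinarith
  | succ N ih =>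
    intro β hβ h hh
    push_cast at hβ
    obtain ⟨C, hC⟩ := ih (β - 1) (by linarith) _ (hh.jacobiDeriv₂ β)
    obtain ⟨C0, hC00, hC0⟩ := exists_abs_one_sub_cos_rpow_mul_le β hh.continuousOn
    obtain ⟨C1, hC10, hC1⟩ :=
      exists_abs_one_sub_cos_rpow_mul_le (β - 1) (hh.jacobiDeriv β).continuousOn
    refine ⟨C0 + C1 + C, fun k hk => ?_⟩
    have hkpos : (0 : ℝ) < k := by positivity
    have hk0 : (0 : ℝ) < 1 / k := by positivity
    have hk1 : (1 / k : ℝ) ≤ π := by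
      have : (1 / k : ℝ) ≤ 1 := by
        rw [div_le_one (by positivity)]; exact_mod_cast hk
      linarith [Real.pi_gt_three]
    have e (s : ℝ) : (1 / k : ℝ) ^ s = (k : ℝ) ^ (-s) := by
      rw [one_div, Real.inv_rpow (by positivity), ← Real.rpow_neg (by positivity)]
    rw [integral_one_sub_cos_rpow_mul_cos β hh hk0 hk1 hk]
    have b0 := hC0 _ hk0 hk1
    have b1 := hC1 _ hk0 hk1
    have b2 := hC k hk
    rw [e] at b0 b1
    set X := (1 - cos (1 / k)) ^ β * h (cos (1 / k))
    set Y := (1 - cos (1 / k)) ^ (β - 1) * jacobiDeriv β h (cos (1 / k))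
    set Z := ∫ t in (1 / k : ℝ)..π, (1 - cos t) ^ (β - 1) * jacobiDeriv₂ β h (cos t) * cos (k * t)
    have t0 : |X * sin (k * (1 / k)) / k| ≤ C0 * (k : ℝ) ^ (-2 * β - 1) := by
      rw [abs_div, abs_of_pos hkpos, abs_mul, Real.rpow_sub_one hkpos.ne',
        ← mul_div_assoc C0]
      refine div_le_div_of_nonneg_right ?_ hkpos.le
      refine (mul_le_of_le_one_right (abs_nonneg _) (Real.abs_sin_le_one _)).trans ?_
      simpa using b0
    have t1 : |sin (1 / k) * Y * cos (k * (1 / k)) / k ^ 2| ≤ C1 * (k : ℝ) ^ (-2 * β - 1) := by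
      rw [abs_div, abs_of_pos (pow_pos hkpos 2)]
      have e1 : (k : ℝ) ^ (-2 * β - 1) = 1 / k * (k : ℝ) ^ (-(2 * (β - 1))) / k ^ 2 := by
        rw [show -(2 * (β - 1)) = (-2 * β - 1) + (3 : ℕ) by push_cast; ring,
          Real.rpow_add_natCast hkpos.ne']
        field_simp
      rw [e1, ← mul_div_assoc C1]
      gcongr
      refine (abs_mul_cos_le _ _).trans ?_
      rw [abs_mul]
      calc |sin (1 / k)| * |Y| ≤ (1 / k) * (C1 * (k : ℝ) ^ (-(2 * (β - 1)))) := by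
            gcongr
            exact (Real.abs_sin_le_abs).trans_eq (abs_of_pos hk0)
        _ = _ := by ring
    have t2 : |Z / k ^ 2| ≤ C * (k : ℝ) ^ (-2 * β - 1) := by
      rw [abs_div, abs_of_pos (pow_pos hkpos 2), div_le_iff₀ (by positivity)]
      refine b2.trans_eq ?_
      rw [show -2 * (β - 1) - 1 = (-2 * β - 1) + (2 : ℕ) by push_cast; ring,
        Real.rpow_add_natCast hkpos.ne']
      ring
    calc _ ≤ |X * sin (k * (1 / k)) / k| + |sin (1 / k) * Y * cos (k * (1 / k)) / k ^ 2|
          + |Z / k ^ 2| := by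
          refine (abs_sub _ _).trans ?_
          gcongr
          refine (abs_add_le _ _).trans ?_
          rw [abs_neg]
      _ ≤ _ := by linarith

/-- The Fourier coefficients of the even function `t ↦ f (cos t)`. -/
noncomputable def cosCoeff (f : ℝ → ℝ) (m : ℤ) : ℝ :=
  (1 / π) * ∫ t in (0 : ℝ)..π, f (cos t) * cos (m * t)

lemma cosCoeff_neg (f : ℝ → ℝ) (m : ℤ) : cosCoeff f (-m) = cosCoeff f m := by
  simp [cosCoeff]

lemma cosCoeff_natAbs (f : ℝ → ℝ) (m : ℤ) : cosCoeff f m.natAbs = cosCoeff f m := by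
  rcases Int.natAbs_eq m with h | h
  · rw [← h]
  · nth_rewrite 2 [h]; rw [cosCoeff_neg]

lemma exists_abs_cosCoeff_le {α : ℝ} (hα : 0 < α) {g : ℝ → ℝ}
    (hg : ContDiffOn ℝ (⊤ : ℕ∞) g (Set.Icc (-1) 1)) :
    ∃ C, 0 ≤ C ∧ ∀ m : ℤ, m ≠ 0 →
      |cosCoeff (fun x => (1 - x) ^ α * g x) m| ≤ C * |(m : ℝ)| ^ (-2 * α - 1) := by
  obtain ⟨N, hN⟩ := exists_nat_gt (α + 1 / 2)
  obtain ⟨C, hC⟩ := exists_abs_integral_one_div_pi_le N α (by linarith) g hg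
  obtain ⟨C0, hC00, hC0⟩ := exists_abs_one_sub_cos_rpow_mul_le α hg.continuousOn
  have bound : ∀ m : ℤ, m ≠ 0 → |cosCoeff (fun x => (1 - x) ^ α * g x) m|
      ≤ (1 / π * (C0 + C)) * |(m : ℝ)| ^ (-2 * α - 1) := by
    intro m hm
    have hk : 1 ≤ m.natAbs := Int.one_le_abs hm |> fun h => by omega
    rw [← cosCoeff_natAbs, ← Int.cast_abs, Int.abs_eq_natAbs]
    generalize m.natAbs = k at hk
    have hkpos : (0 : ℝ) < k := by positivity
    have hk0 : (0 : ℝ) < 1 / k := by positivity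
    have hk1 : (1 / k : ℝ) ≤ π := by
      have : (1 / k : ℝ) ≤ 1 := by
        rw [div_le_one (by positivity)]; exact_mod_cast hk
      linarith [Real.pi_gt_three]
    have hcont : Continuous fun t : ℝ => (1 - cos t) ^ α * g (cos t) * cos (k * t) :=
      ((Continuous.rpow_const (by fun_prop) fun _ => Or.inr hα.le).mul
        (continuous_comp_cos hg.continuousOn)).mul (by fun_prop)
    simp only [cosCoeff, Int.cast_natCast]
    rw [abs_mul, abs_of_pos (by positivity), mul_assoc]
    gcongr
    rw [← intervalIntegral.integral_add_adjacent_intervals (hcont.intervalIntegrable 0 (1 / k))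
      (hcont.intervalIntegrable (1 / k) π), add_mul]
    refine (abs_add_le _ _).trans (add_le_add ?_ (hC k hk))
    rw [← Real.norm_eq_abs]
    refine (intervalIntegral.norm_integral_le_of_norm_le_const
      (C := C0 * (1 / k : ℝ) ^ (2 * α)) fun t ht => ?_).trans_eq ?_
    · rw [Set.uIoc_of_le hk0.le] at ht
      refine (abs_mul_cos_le _ _).trans ((hC0 t ht.1 (ht.2.trans hk1)).trans ?_)
      gcongr
      exacts [ht.1.le, ht.2]
    · rw [sub_zero, abs_of_pos hk0, Real.rpow_sub_one hkpos.ne', one_div,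
        Real.inv_rpow hkpos.le, ← Real.rpow_neg hkpos.le]
      ring_nf
  refine ⟨1 / π * (C0 + C), ?_, bound⟩
  simpa using (abs_nonneg _).trans (bound 1 one_ne_zero)

lemma cosCoeff_second_diff {f : ℝ → ℝ} (hf : ContinuousOn f (Set.Icc (-1) 1)) (m : ℤ) :
    cosCoeff f (m + 1) + cosCoeff f (m - 1) - 2 * cosCoeff f m =
      -2 * cosCoeff (fun x => (1 - x) * f x) m := by
  have hc := continuous_comp_cos hf
  have hi (r : ℝ) : IntervalIntegrable (fun t => f (cos t) * cos (r * t))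
      MeasureTheory.volume 0 π := Continuous.intervalIntegrable (hc.mul (by fun_prop)) _ _
  simp only [cosCoeff]
  rw [show ∀ a b c d : ℝ, (a * b + a * c - 2 * (a * d) = a * (b + c - 2 * d)) by intros; ring,
    mul_left_comm]
  congr 1
  rw [← intervalIntegral.integral_add (hi _) (hi _), ← intervalIntegral.integral_const_mul,
    ← intervalIntegral.integral_const_mul,
    ← intervalIntegral.integral_sub ((hi _).add (hi _)) ((hi _).const_mul 2)]
  congr 1 with t
  push_cast
  rw [add_mul, sub_mul, Real.cos_add, Real.cos_sub, one_mul]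
  ring

lemma hasSum_cosCoeff_mul_cos {f : ℝ → ℝ} (hf : ContinuousOn f (Set.Icc (-1) 1))
    (hs : Summable (cosCoeff f)) (t : ℝ) :
    HasSum (fun m : ℤ => cosCoeff f m * cos (m * t)) (f (cos t)) := by
  have : Fact (0 < 2 * π) := ⟨Real.two_pi_pos⟩
  have hc : Continuous fun t : ℝ => ((f (cos t) : ℝ) : ℂ) :=
    Complex.continuous_ofReal.comp (continuous_comp_cos hf)
  have hper : Function.Periodic (fun t : ℝ => ((f (cos t) : ℝ) : ℂ)) (2 * π) := fun t => by
    simp only [Real.cos_add_two_pi]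
  let F : C(AddCircle (2 * π), ℂ) := ⟨hper.lift, hc.quotient_liftOn' _⟩
  have hF (t : ℝ) : F t = (f (cos t) : ℂ) := hper.lift_coe t
  have hfour (m : ℤ) (t : ℝ) : fourier m (t : AddCircle (2 * π))
      = (cos (m * t) : ℂ) + (sin (m * t) : ℂ) * Complex.I := by
    rw [fourier_coe_apply, Complex.ofReal_cos, Complex.ofReal_sin, ← Complex.exp_mul_I]
    congr 1
    push_cast
    field_simp [Real.pi_ne_zero]
  have hcoeff (m : ℤ) : fourierCoeff F m = (cosCoeff f m : ℂ) := by
    rw [fourierCoeff_eq_intervalIntegral _ _ (-π), show -π + 2 * π = π by ring]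
    have hφ : Continuous fun x : ℝ => fourier (-m) (x : AddCircle (2 * π)) • F x :=
      ((fourier (-m)).continuous.comp (AddCircle.continuous_mk' _)).smul
        (F.continuous.comp (AddCircle.continuous_mk' _))
    have hneg := intervalIntegral.integral_comp_neg (a := 0) (b := π)
      fun x : ℝ => fourier (-m) (x : AddCircle (2 * π)) • F x
    rw [neg_zero] at hneg
    rw [← intervalIntegral.integral_add_adjacent_intervals (hφ.intervalIntegrable (-π) 0)
      (hφ.intervalIntegrable 0 π), ← hneg, ← intervalIntegral.integral_add
      (Continuous.intervalIntegrable (by exact hφ.comp continuous_neg) 0 π)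
      (hφ.intervalIntegrable 0 π)]
    have hsum (x : ℝ) : fourier (-m) ((-x : ℝ) : AddCircle (2 * π)) • F ((-x : ℝ) : AddCircle (2 * π))
        + fourier (-m) (x : AddCircle (2 * π)) • F x
        = ((2 * (f (cos x) * cos (m * x)) : ℝ) : ℂ) := by
      rw [hfour, hfour, hF, hF, Real.cos_neg]
      simp only [Int.cast_neg, neg_mul, mul_neg, neg_neg, Real.cos_neg, Real.sin_neg,
        Complex.ofReal_neg, smul_eq_mul]
      push_cast
      ring
    simp only [hsum]
    rw [intervalIntegral.integral_ofReal, intervalIntegral.integral_const_mul, cosCoeff,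
      Complex.real_smul, ← Complex.ofReal_mul]
    congr 1
    field_simp
  have hsC : Summable (fourierCoeff F) := by
    rw [show fourierCoeff F = fun m => (cosCoeff f m : ℂ) from funext hcoeff]
    exact Complex.ofRealCLM.summable hs
  have := Complex.reCLM.hasSum (has_pointwise_sum_fourier_series_of_summable hsC t)
  rw [hF] at this
  refine this.congr_fun fun m => ?_
  simp only [hcoeff, hfour, Complex.reCLM_apply, smul_eq_mul,
    Complex.add_re, Complex.ofReal_re, Complex.mul_re, Complex.I_re, Complex.I_im,
    Complex.ofReal_im]
  ring

/-- The moment `∫₀^π cos(mt) sin t dt`. -/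
noncomputable def cosMoment (m : ℤ) : ℝ := (1 + cos (m * π)) / (1 - (m : ℝ) ^ 2)

lemma integral_cos_mul_sin_eq_cosMoment (m : ℤ) :
    ∫ t in (0 : ℝ)..π, cos (m * t) * sin t = cosMoment m := by
  by_cases hm : (m : ℝ) ^ 2 = 1
  · have h1 : ∀ t : ℝ, cos (m * t) = cos t := fun t => by
      rcases sq_eq_one_iff.1 hm with h | h <;> simp [h]
    simp only [h1, cosMoment, Real.cos_pi, add_neg_cancel, zero_div]
    simp only [mul_comm (cos _), integral_sin_mul_cos₁, Real.sin_pi, Real.sin_zero]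
    norm_num
  · have hm' : (m : ℝ) ^ 2 - 1 ≠ 0 := sub_ne_zero.2 hm
    have hd (t : ℝ) : HasDerivAt
        (fun t : ℝ => (cos t * cos (m * t) + m * (sin t * sin (m * t))) / ((m : ℝ) ^ 2 - 1))
        (cos (m * t) * sin t) t := by
      have hmt : HasDerivAt (fun t : ℝ => (m : ℝ) * t) m t := by
        simpa using (hasDerivAt_id t).const_mul (m : ℝ)
      refine ((((Real.hasDerivAt_cos t).mul hmt.cos).add
        (((Real.hasDerivAt_sin t).mul hmt.sin).const_mul (m : ℝ))).div_const _).congr_deriv ?_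
      field_simp
      ring
    rw [intervalIntegral.integral_eq_sub_of_hasDerivAt (fun t _ => hd t)
      (Continuous.intervalIntegrable (by fun_prop) _ _), cosMoment, ← neg_div_neg_eq (1 + _)]
    simp only [Real.cos_pi, Real.sin_pi, mul_zero, Real.cos_zero, Real.sin_zero]
    rw [neg_sub]
    ring

lemma hasSum_cosCoeff_mul_cosMoment {f : ℝ → ℝ} (hf : ContinuousOn f (Set.Icc (-1) 1))
    (hs : Summable (cosCoeff f)) :
    HasSum (fun m : ℤ => cosCoeff f m * cosMoment m) (∫ x in (-1 : ℝ)..1, f x) := by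
  have hsub : ∫ x in (-1 : ℝ)..1, f x = ∫ t in (0 : ℝ)..π, f (cos t) * sin t := by
    have := intervalIntegral.integral_comp_mul_deriv'' (a := 0) (b := π) (f := cos)
      (f' := fun t => -sin t) (g := f) Real.continuous_cos.continuousOn
      (fun t _ => (Real.hasDerivAt_cos t).hasDerivWithinAt) (by fun_prop)
      (hf.mono (by rintro _ ⟨t, _, rfl⟩; exact cos_mem_Icc' t))
    rw [Real.cos_zero, Real.cos_pi, intervalIntegral.integral_symm] at this
    simp only [Function.comp_apply, mul_neg, intervalIntegral.integral_neg] at this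
    rw [intervalIntegral.integral_symm, ← this, intervalIntegral.integral_symm 0 π, neg_neg,
      neg_neg]
  rw [hsub]
  have key := intervalIntegral.hasSum_integral_of_dominated_convergence (a := 0) (b := π)
    (μ := MeasureTheory.volume) (F := fun (m : ℤ) t => cosCoeff f m * cos (m * t) * sin t)
    (f := fun t => f (cos t) * sin t)
    (fun m _ => |cosCoeff f m|) (fun m => Continuous.aestronglyMeasurable (by fun_prop))
    (fun m => Filter.Eventually.of_forall fun t _ => ?_)
    (Filter.Eventually.of_forall fun t _ => hs.abs)
    intervalIntegrable_const
    (Filter.Eventually.of_forall fun t _ => (hasSum_cosCoeff_mul_cos hf hs t).mul_right _)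
  · refine key.congr_fun fun m => ?_
    simp only [mul_assoc, intervalIntegral.integral_const_mul, integral_cos_mul_sin_eq_cosMoment]
  · rw [Real.norm_eq_abs, abs_mul]
    exact (mul_le_of_le_one_right (abs_nonneg _) (Real.abs_sin_le_one t)).trans
      (abs_mul_cos_le _ _)

lemma cosMoment_two_mul (k : ℤ) : cosMoment (2 * k) = 2 / (1 - 4 * (k : ℝ) ^ 2) := by
  rw [cosMoment]
  push_cast
  rw [show (2 * (k : ℝ)) * π = k * (2 * π) by ring, Real.cos_int_mul_two_pi]
  ring

lemma cosMoment_two_mul_add_one (k : ℤ) : cosMoment (2 * k + 1) = 0 := by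
  rw [cosMoment]
  push_cast
  rw [show (2 * (k : ℝ) + 1) * π = π + k * (2 * π) by ring, Real.cos_add_int_mul_two_pi,
    Real.cos_pi]
  simp

lemma hasSum_cosCoeff_two_mul {f : ℝ → ℝ} (hf : ContinuousOn f (Set.Icc (-1) 1))
    (hs : Summable (cosCoeff f)) :
    HasSum (fun k : ℕ => 4 * cosCoeff f (2 * k) / (1 - 4 * (k : ℝ) ^ 2))
      ((∫ x in (-1 : ℝ)..1, f x) + 2 * cosCoeff f 0) := by
  have h := hasSum_cosCoeff_mul_cosMoment hf hs
  have hinj : Function.Injective fun k : ℤ => 2 * k := fun a b h => by simpa using h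
  rw [← hinj.hasSum_iff] at h
  · have h2 := h.nat_add_neg
    convert h2 using 1
    · ext k
      simp only [Function.comp_apply]
      rw [mul_neg, cosCoeff_neg, ← mul_neg, cosMoment_two_mul, cosMoment_two_mul]
      push_cast
      ring
    · simp [cosMoment, mul_comm]; norm_num
  · intro m hm
    rcases Int.even_or_odd' m with ⟨k, rfl | rfl⟩
    · exact absurd ⟨k, rfl⟩ hm
    · rw [cosMoment_two_mul_add_one, mul_zero]

lemma sum_ccDelta_mul {n : ℕ} (hn : 1 ≤ n) (x : ℕ → ℝ) :
    ∑ j ∈ Finset.range (n + 1), ccDelta n j * x j =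
      ∑ j ∈ Finset.range n, (x j + x (j + 1)) / 2 := by
  have h1 : ∀ j ∈ Finset.range (n + 1), ccDelta n j * x j =
      x j - (if j = 0 then x j / 2 else 0) - (if j = n then x j / 2 else 0) := by
    intro j _
    unfold ccDelta
    split_ifs <;> first | omega | ring_nf
  rw [Finset.sum_congr rfl h1, Finset.sum_sub_distrib, Finset.sum_sub_distrib,
    Finset.sum_ite_eq', Finset.sum_ite_eq', if_pos (by simp), if_pos (by simp)]
  simp only [add_div, Finset.sum_add_distrib]
  rw [← Finset.sum_div, ← Finset.sum_div]
  have e1 := Finset.sum_range_succ x n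
  have e2 := Finset.sum_range_succ' x n
  linarith

lemma sum_ccDelta_mul_cos {n : ℕ} (hn : 1 ≤ n) (q : ℤ) :
    ∑ j ∈ Finset.range (n + 1), ccDelta n j * cos (q * (j * π / n)) =
      if (2 * n : ℤ) ∣ q then (n : ℝ) else 0 := by
  have hn0 : (n : ℝ) ≠ 0 := by positivity
  rw [sum_ccDelta_mul hn fun j => cos (q * (j * π / n))]
  split_ifs with hq
  · obtain ⟨p, rfl⟩ := hq
    have h1 (j : ℕ) : cos (((2 * n * p : ℤ) : ℝ) * (j * π / n)) = 1 := by
      rw [← Real.cos_int_mul_two_pi (p * j)]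
      congr 1
      push_cast
      field_simp
    simp only [h1]
    simp
  · set θ : ℝ := q * π / n with hθ
    have h1 (j : ℕ) : cos (q * (j * π / n)) = cos (j * θ) := by
      rw [hθ]; congr 1; ring
    simp only [h1]
    have hsin : sin (θ / 2) ≠ 0 := by
      intro h0
      obtain ⟨p, hp⟩ := Real.sin_eq_zero_iff.1 h0
      apply hq
      refine ⟨p, ?_⟩
      have : (q : ℝ) = 2 * n * p := by
        rw [hθ] at hp
        field_simp at hp
        linarith
      exact_mod_cast this
    have htel (j : ℕ) : (cos (j * θ) + cos ((j + 1 : ℕ) * θ)) / 2 =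
        cos (θ / 2) / (2 * sin (θ / 2)) * (sin ((j + 1 : ℕ) * θ) - sin (j * θ)) := by
      rw [div_mul_eq_mul_div, div_eq_div_iff two_ne_zero (by positivity)]
      obtain ⟨y, hy⟩ : ∃ y, y = j * θ + θ / 2 := ⟨_, rfl⟩
      rw [show (j : ℝ) * θ = y - θ / 2 by rw [hy]; ring,
        show ((j + 1 : ℕ) : ℝ) * θ = y + θ / 2 by rw [hy]; push_cast; ring,
        Real.cos_add, Real.cos_sub, Real.sin_add, Real.sin_sub]
      ring
    simp only [htel]
    rw [← Finset.mul_sum, Finset.sum_range_sub (fun j : ℕ => sin (j * θ))]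
    have : (n : ℝ) * θ = q * π := by rw [hθ]; field_simp
    simp [this, Real.sin_int_mul_pi]

/-- The discrete cosine coefficients of `t ↦ f (cos t)` on the grid `jπ/n`. -/
noncomputable def discreteCosCoeff (f : ℝ → ℝ) (n : ℕ) (l : ℤ) : ℝ :=
  (2 / n) * ∑ j ∈ Finset.range (n + 1),
    ccDelta n j * (cos (l * (j * π / n)) * f (cos (j * π / n)))

lemma ccQuad_eq_sum_discreteCosCoeff (f : ℝ → ℝ) (n : ℕ) :
    ccQuad f n = ∑ k ∈ Finset.range (n / 2 + 1),
      ccDelta n (2 * k) * (2 / (1 - 4 * (k : ℝ) ^ 2)) * discreteCosCoeff f n (2 * k) := by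
  simp only [ccQuad, ccWeight, discreteCosCoeff, Finset.mul_sum, Finset.sum_mul]
  rw [Finset.sum_comm]
  refine Finset.sum_congr rfl fun k _ => Finset.sum_congr rfl fun j _ => ?_
  have : cos (((2 * k : ℤ) : ℝ) * (j * π / n)) = cos (2 * (j : ℝ) * (k : ℝ) * π / (n : ℝ)) := by
    congr 1; push_cast; ring
  rw [this]
  ring

lemma two_div_mul_sum_ccDelta_mul_cos_mul_cos {n : ℕ} (hn : 1 ≤ n) (l m : ℤ) :
    (2 / n) * ∑ j ∈ Finset.range (n + 1),
      ccDelta n j * (cos (l * (j * π / n)) * cos (m * (j * π / n))) =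
      (if (2 * n : ℤ) ∣ m - l then (1 : ℝ) else 0) + if (2 * n : ℤ) ∣ m + l then 1 else 0 := by
  have hn0 : (n : ℝ) ≠ 0 := by positivity
  have h (j : ℕ) : ccDelta n j * (cos (l * (j * π / n)) * cos (m * (j * π / n))) =
      (ccDelta n j * cos ((m - l : ℤ) * (j * π / n))
        + ccDelta n j * cos ((m + l : ℤ) * (j * π / n))) / 2 := by
    push_cast
    rw [sub_mul, add_mul, Real.cos_sub, Real.cos_add]
    ring
  simp only [h]
  rw [← Finset.sum_div, Finset.sum_add_distrib, sum_ccDelta_mul_cos hn, sum_ccDelta_mul_cos hn]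
  split_ifs <;> field_simp <;> norm_num

lemma hasSum_mul_ite_dvd_sub {c : ℤ → ℝ} (hs : Summable c) {n : ℕ} (hn : 1 ≤ n) (l : ℤ) :
    HasSum (fun m : ℤ => c m * if (2 * n : ℤ) ∣ m - l then (1 : ℝ) else 0)
      (∑' p : ℤ, c (l + 2 * n * p)) := by
  have hinj : Function.Injective fun p : ℤ => l + 2 * n * p := fun a b h => by
    simpa [show n ≠ 0 by omega] using h
  rw [← hinj.hasSum_iff]
  · refine (hs.comp_injective hinj).hasSum.congr_fun fun p => ?_
    simp
  · intro m hm
    rw [if_neg, mul_zero]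
    rintro ⟨p, hp⟩
    exact hm ⟨p, by simp only; rw [← hp]; ring⟩

lemma hasSum_aliasing {f : ℝ → ℝ} (hf : ContinuousOn f (Set.Icc (-1) 1))
    (hs : Summable (cosCoeff f)) {n : ℕ} (hn : 1 ≤ n) (l : ℤ) :
    HasSum (fun p : ℕ => 2 * (cosCoeff f (2 * n * (p + 1) + l) + cosCoeff f (2 * n * (p + 1) - l)))
      (discreteCosCoeff f n l - 2 * cosCoeff f l) := by
  have h1 : HasSum (fun m : ℤ => cosCoeff f m *
      ((if (2 * n : ℤ) ∣ m - l then (1 : ℝ) else 0) + if (2 * n : ℤ) ∣ m + l then 1 else 0))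
      (discreteCosCoeff f n l) := by
    have := (hasSum_sum (s := Finset.range (n + 1)) fun j _ =>
      ((hasSum_cosCoeff_mul_cos hf hs (j * π / n)).mul_left
        (ccDelta n j * cos (l * (j * π / n))))).mul_left (2 / n : ℝ)
    simp only [discreteCosCoeff, ← mul_assoc (ccDelta _ _)]
    refine this.congr_fun fun m => ?_
    rw [← two_div_mul_sum_ccDelta_mul_cos_mul_cos hn, mul_left_comm, Finset.mul_sum]
    congr 1
    exact Finset.sum_congr rfl fun j _ => by ring
  have h2 : HasSum (fun m : ℤ => cosCoeff f m *
      ((if (2 * n : ℤ) ∣ m - l then (1 : ℝ) else 0) + if (2 * n : ℤ) ∣ m + l then 1 else 0))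
      (∑' p : ℤ, cosCoeff f (l + 2 * n * p) + ∑' p : ℤ, cosCoeff f (-l + 2 * n * p)) := by
    refine ((hasSum_mul_ite_dvd_sub hs hn l).add
      (hasSum_mul_ite_dvd_sub hs hn (-l))).congr_fun fun m => ?_
    rw [mul_add, sub_neg_eq_add]
  have hsum (l : ℤ) : Summable fun p : ℤ => cosCoeff f (l + 2 * n * p) :=
    hs.comp_injective fun a b h => by
        simpa [show n ≠ 0 by omega] using h
  have h3 := ((hsum l).hasSum.add (hsum (-l)).hasSum).nat_add_neg
  rw [← h1.unique h2] at h3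
  have h4 := (hasSum_nat_add_iff' 1).2 h3
  have e : discreteCosCoeff f n l + (cosCoeff f (l + 2 * n * 0) + cosCoeff f (-l + 2 * n * 0)) -
      ∑ i ∈ Finset.range 1, (cosCoeff f (l + 2 * n * i) + cosCoeff f (-l + 2 * n * i) +
        (cosCoeff f (l + 2 * n * -i) + cosCoeff f (-l + 2 * n * -i))) =
      discreteCosCoeff f n l - 2 * cosCoeff f l := by
    simp [cosCoeff_neg]
    ring
  rw [e] at h4
  refine h4.congr_fun fun p => ?_
  rw [← cosCoeff_neg f (l + 2 * n * -_), ← cosCoeff_neg f (-l + 2 * n * -_)]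
  push_cast
  ring_nf

lemma ccDelta_nonneg (n j : ℕ) : 0 ≤ ccDelta n j := by
  unfold ccDelta; split_ifs <;> norm_num

lemma ccDelta_le_one (n j : ℕ) : ccDelta n j ≤ 1 := by
  unfold ccDelta; split_ifs <;> norm_num

lemma sum_ccDelta_two_mul_mul {n : ℕ} (hn : 1 ≤ n) (y : ℕ → ℝ) :
    ∑ k ∈ Finset.range (n / 2 + 1), ccDelta n (2 * k) * y k =
      ∑ k ∈ Finset.range (n / 2 + 1), y k - y 0 / 2 -
        if 2 * (n / 2) = n then y (n / 2) / 2 else 0 := by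
  have h1 : ∀ k ∈ Finset.range (n / 2 + 1), ccDelta n (2 * k) * y k =
      y k - (if k = 0 then y k / 2 else 0) -
        (if k = n / 2 then (if 2 * (n / 2) = n then y k / 2 else 0) else 0) := by
    intro k _
    unfold ccDelta
    split_ifs <;> first | omega | ring
  rw [Finset.sum_congr rfl h1, Finset.sum_sub_distrib, Finset.sum_sub_distrib,
    Finset.sum_ite_eq', Finset.sum_ite_eq', if_pos (by simp), if_pos (by simp)]

lemma sum_range_two_div (K : ℕ) :
    ∑ k ∈ Finset.range (K + 1), 2 / (1 - 4 * (k : ℝ) ^ 2) = 1 + 1 / (2 * (K : ℝ) + 1) := by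
  induction K with
  | zero => norm_num
  | succ K ih =>
    rw [Finset.sum_range_succ, ih]
    push_cast
    have h1 : (2 * (K : ℝ) + 1) ≠ 0 := by positivity
    have h2 : (2 * ((K : ℝ) + 1) + 1) ≠ 0 := by positivity
    have h3 : 1 - 4 * ((K : ℝ) + 1) ^ 2 = -((2 * K + 1) * (2 * (K + 1) + 1)) := by ring
    rw [h3]
    field_simp
    ring

lemma abs_one_div_one_sub_sq_le {n : ℕ} (hn : 2 ≤ n) :
    |1 / (1 - (n : ℝ) ^ 2)| ≤ 2 / (n : ℝ) := by
  have h2 : (2 : ℝ) ≤ n := by exact_mod_cast hn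
  rw [abs_div, abs_one, abs_sub_comm, abs_of_pos (by nlinarith),
    div_le_div_iff₀ (by nlinarith) (by linarith)]
  nlinarith

lemma one_div_two_mul_div_two_add_one_le {n : ℕ} (hn : 1 ≤ n) :
    1 / (2 * ((n / 2 : ℕ) : ℝ) + 1) ≤ 1 / (n : ℝ) := by
  have : (n : ℝ) ≤ 2 * ((n / 2 : ℕ) : ℝ) + 1 := by exact_mod_cast (by omega : n ≤ 2 * (n / 2) + 1)
  have hn0 : (0 : ℝ) < n := by positivity
  gcongr

lemma abs_sum_ccDelta_two_mul_le {n : ℕ} (hn : 1 ≤ n) :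
    |∑ k ∈ Finset.range (n / 2 + 1), ccDelta n (2 * k) * (2 / (1 - 4 * (k : ℝ) ^ 2))| ≤
      3 / (n : ℝ) := by
  rw [sum_ccDelta_two_mul_mul hn, sum_range_two_div]
  have h1 := one_div_two_mul_div_two_add_one_le hn
  have h0 : 0 ≤ 1 / (2 * ((n / 2 : ℕ) : ℝ) + 1) := by positivity
  have e : (3 / n : ℝ) = 1 / n + 2 / n := by ring
  have hn0 : (0 : ℝ) < 2 / n := by positivity
  rw [e, show ∀ x y : ℝ, 1 + x - 2 / (1 - 4 * ((0 : ℕ) : ℝ) ^ 2) / 2 - y = x - y by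
    intros; norm_num]
  refine (abs_sub _ _).trans (add_le_add (by rwa [abs_of_nonneg h0]) ?_)
  split_ifs with h
  · have : (n : ℝ) = 2 * ((n / 2 : ℕ) : ℝ) := by exact_mod_cast h.symm
    have e2 : 2 / (1 - 4 * ((n / 2 : ℕ) : ℝ) ^ 2) / 2 = 1 / (1 - (n : ℝ) ^ 2) := by
      rw [this]; ring
    rw [e2]
    exact abs_one_div_one_sub_sq_le (by omega)
  · simpa using hn0.le

lemma abs_add_sub_two_mul_le {c : ℤ → ℝ} {m : ℤ} {J : ℕ} {M : ℝ}
    (h : ∀ i : ℤ, |i - m| < J → |c (i + 1) + c (i - 1) - 2 * c i| ≤ M) :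
    |c (m + J) + c (m - J) - 2 * c m| ≤ J ^ 2 * M := by
  have key : ∀ j : ℕ, j < J →
      |(c (m + (j + 1)) + c (m - (j + 1))) - (c (m + j) + c (m - j))| ≤ (2 * j + 1) * M ∧
      |c (m + (j + 1)) + c (m - (j + 1)) - 2 * c m| ≤ (j + 1) ^ 2 * M := by
    intro j
    induction j with
    | zero =>
      intro hj
      have := h m (by simpa using hj)
      simp only [Nat.cast_zero, zero_add, add_zero, sub_zero, mul_zero, one_mul, one_pow]
      rw [← two_mul]
      exact ⟨this, this⟩
    | succ j ih =>
      intro hj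
      obtain ⟨h1, h2⟩ := ih (by omega)
      have a1 := h (m + (j + 1)) (by rw [abs_lt]; constructor <;> omega)
      have a2 := h (m - (j + 1)) (by rw [abs_lt]; constructor <;> omega)
      have e1 : m + ((j : ℤ) + 1) - 1 = m + j := by ring
      have e2 : m - ((j : ℤ) + 1) + 1 = m - j := by ring
      have e3 : m + ((j : ℤ) + 1) + 1 = m + (j + 1 + 1) := by ring
      have e4 : m - ((j : ℤ) + 1) - 1 = m - (j + 1 + 1) := by ring
      rw [e1, e3] at a1
      rw [e2, e4] at a2
      push_cast
      rw [abs_le] at h1 h2 a1 a2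
      rw [abs_le, abs_le]
      constructor <;> constructor <;> linarith
  rcases J with _ | J
  · simp [two_mul]
  · have := (key J (by omega)).2
    push_cast
    exact this

lemma tsum_le_and_summable_one_div (K : ℕ) :
    Summable (fun k : ℕ => 1 / (4 * ((k : ℝ) + K + 1) ^ 2 - 1)) ∧
    ∑' k : ℕ, 1 / (4 * ((k : ℝ) + K + 1) ^ 2 - 1) ≤ 1 / (2 * (K : ℝ) + 1) := by
  have hpos (k : ℕ) : 0 ≤ 1 / (4 * ((k : ℝ) + K + 1) ^ 2 - 1) := by
    have : (1 : ℝ) ≤ k + K + 1 := by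
      have : (0 : ℝ) ≤ (k : ℝ) + K := by positivity
      linarith
    have : 0 < 4 * ((k : ℝ) + K + 1) ^ 2 - 1 := by nlinarith
    positivity
  have hsum (N : ℕ) : ∑ k ∈ Finset.range N, 1 / (4 * ((k : ℝ) + K + 1) ^ 2 - 1)
      ≤ 1 / (2 * (K : ℝ) + 1) := by
    have : ∑ k ∈ Finset.range N, 1 / (4 * ((k : ℝ) + K + 1) ^ 2 - 1)
        = (1 / (2 * (K : ℝ) + 1) - 1 / (2 * ((N : ℝ) + K) + 1)) / 2 := by
      induction N with
      | zero => simp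
      | succ N ih =>
        rw [Finset.sum_range_succ, ih]
        push_cast
        have h1 : (2 * (K : ℝ) + 1) ≠ 0 := by positivity
        have h2 : (2 * ((N : ℝ) + K) + 1) ≠ 0 := by positivity
        have h4 : (2 * ((N : ℝ) + 1 + K) + 1) ≠ 0 := by positivity
        have h3 : 4 * ((N : ℝ) + K + 1) ^ 2 - 1
          = (2 * ((N : ℝ) + K) + 1) * (2 * ((N : ℝ) + 1 + K) + 1) := by ring
        rw [h3]
        field_simp
        ring
    rw [this]
    have h1 : (0 : ℝ) ≤ 1 / (2 * (K : ℝ) + 1) := by positivity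
    have h2 : (0 : ℝ) ≤ 1 / (2 * ((N : ℝ) + K) + 1) := by positivity
    linarith
  exact ⟨summable_of_sum_range_le hpos hsum, Real.tsum_le_of_sum_range_le hpos hsum⟩

lemma abs_two_div_mul_four_mul_sq_le (k : ℕ) :
    |2 / (1 - 4 * (k : ℝ) ^ 2)| * (4 * (k : ℝ) ^ 2) ≤ 3 := by
  rcases Nat.eq_zero_or_pos k with rfl | hk
  · norm_num
  · have hk1 : (1 : ℝ) ≤ k := by exact_mod_cast hk
    rw [abs_div, abs_two, abs_sub_comm, abs_of_pos (by nlinarith), div_mul_eq_mul_div,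
      div_le_iff₀ (by nlinarith)]
    nlinarith

lemma exists_abs_ccError_le {f : ℝ → ℝ} (hf : ContinuousOn f (Set.Icc (-1) 1)) {C s : ℝ}
    (hC : 0 ≤ C) (hs : 1 < s)
    (h1 : ∀ m : ℤ, m ≠ 0 → |cosCoeff f m| ≤ C * |(m : ℝ)| ^ (-s))
    (h2 : ∀ m : ℤ, m ≠ 0 → |cosCoeff f (m + 1) + cosCoeff f (m - 1) - 2 * cosCoeff f m| ≤
      C * |(m : ℝ)| ^ (-s - 2)) :
    ∃ B, ∀ n : ℕ, 1 ≤ n → |ccError f n| ≤ B * (n : ℝ) ^ (-s - 1) := by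
  have hsum : Summable (cosCoeff f) := by
    refine ((Real.summable_abs_int_rpow hs).mul_left C).of_norm_bounded_eventually ?_
    filter_upwards [(Set.finite_singleton (0 : ℤ)).compl_mem_cofinite] with m hm using h1 m hm
  have hZ : Summable fun p : ℕ => ((p : ℝ) + 1) ^ (-s) := by
    have := (summable_nat_add_iff 1).2 (Real.summable_nat_rpow.2 (by linarith : -s < -1))
    simpa using this
  set c := cosCoeff f with hc
  refine ⟨4 * C + 4 * C + 24 * C * ∑' p : ℕ, ((p : ℝ) + 1) ^ (-s), fun n hn => ?_⟩
  have hn0 : (0 : ℝ) < n := by positivity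
  have hn1 : (1 : ℝ) ≤ n := by exact_mod_cast hn
  set N : ℝ := (n : ℝ) ^ (-s - 1) with hN
  have hN0 : 0 ≤ N := by positivity
  have hNs : (n : ℝ) ^ (-s) = N * n := by
    rw [hN, ← Real.rpow_add_one hn0.ne']; ring_nf
  have hNs2 : (n : ℝ) ^ (-s - 2) = N / n := by
    rw [hN, ← Real.rpow_sub_one hn0.ne']; ring_nf
  -- decay of the coefficients beyond `n`
  have hdecay (k : ℕ) (hk : n ≤ 2 * k) : |c (2 * k)| ≤ C * (N * n) := by
    refine (h1 _ (by omega)).trans ?_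
    rw [← hNs]
    gcongr ?_ * ?_
    refine Real.rpow_le_rpow_of_nonpos hn0 ?_ (by linarith)
    rw [abs_of_nonneg (by positivity)]
    exact_mod_cast hk
  -- aliasing contribution
  set R : ℕ → ℝ := fun k => discreteCosCoeff f n (2 * k) - 2 * c (2 * k) with hR
  set w : ℕ → ℝ := fun k => ccDelta n (2 * k) * (2 / (1 - 4 * (k : ℝ) ^ 2)) with hw
  have hRsum : HasSum (fun p : ℕ => ∑ k ∈ Finset.range (n / 2 + 1), w k *
      (2 * (c (2 * n * (p + 1) + (2 * k : ℤ)) + c (2 * n * (p + 1) - (2 * k : ℤ)))))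
      (∑ k ∈ Finset.range (n / 2 + 1), w k * R k) :=
    hasSum_sum fun k _ => (hasSum_aliasing hf hsum hn (2 * k)).mul_left (w k)
  have hterm (p : ℕ) : ‖∑ k ∈ Finset.range (n / 2 + 1), w k *
      (2 * (c (2 * n * (p + 1) + (2 * k : ℤ)) + c (2 * n * (p + 1) - (2 * k : ℤ))))‖ ≤
      24 * C * N * ((p : ℝ) + 1) ^ (-s) := by
    set m : ℤ := 2 * n * (p + 1) with hm
    set q : ℝ := ((p : ℝ) + 1) ^ (-s) with hq
    have hp0 : (0 : ℝ) < p + 1 := by positivity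
    have hq0 : 0 ≤ q := by positivity
    have hmn : (n : ℤ) * (p + 1) + n ≤ m := by
      rw [hm]; nlinarith [(by positivity : (0 : ℤ) ≤ n * p)]
    have hnp : 0 < (n : ℤ) * (p + 1) := by positivity
    have hcm : |c m| ≤ C * (N * n * q) := by
      refine (h1 m (by omega)).trans ?_
      rw [← hNs, hq, ← Real.mul_rpow hn0.le hp0.le]
      gcongr ?_ * ?_
      refine Real.rpow_le_rpow_of_nonpos (by positivity) ?_ (by linarith)
      refine le_trans ?_ (le_abs_self _)
      have : (n : ℤ) * (p + 1) ≤ m := by omega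
      exact_mod_cast this
    have hD (k : ℕ) (hk : 2 * k ≤ n) :
        |c (m + (2 * k : ℤ)) + c (m - (2 * k : ℤ)) - 2 * c m| ≤
          4 * (k : ℝ) ^ 2 * (C * (N / n * q)) := by
      have := abs_add_sub_two_mul_le (c := c) (m := m) (J := 2 * k) (M := C * (N / n * q)) ?_
      · push_cast at this
        refine this.trans_eq ?_
        ring
      · intro i hi
        rw [abs_lt] at hi
        have hi2 : (n : ℤ) * (p + 1) ≤ i := by push_cast at hi; omega
        refine (h2 i (by omega)).trans ?_
        have hb : (n * (p + 1) : ℝ) ≤ |(i : ℝ)| := by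
          refine le_trans ?_ (le_abs_self _)
          exact_mod_cast hi2
        gcongr ?_ * ?_
        refine (Real.rpow_le_rpow_of_nonpos (by positivity) hb (by linarith)).trans ?_
        rw [Real.mul_rpow hn0.le hp0.le, hNs2]
        exact mul_le_mul_of_nonneg_left (Real.rpow_le_rpow_of_exponent_le
          (by linarith [(by positivity : (0 : ℝ) ≤ p)]) (by linarith)) (by positivity)
    have hsplit : ∑ k ∈ Finset.range (n / 2 + 1), w k *
        (2 * (c (m + (2 * k : ℤ)) + c (m - (2 * k : ℤ)))) =
        2 * ∑ k ∈ Finset.range (n / 2 + 1), w k *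
          (c (m + (2 * k : ℤ)) + c (m - (2 * k : ℤ)) - 2 * c m) +
        4 * c m * ∑ k ∈ Finset.range (n / 2 + 1), w k := by
      rw [Finset.mul_sum, Finset.mul_sum, ← Finset.sum_add_distrib]
      exact Finset.sum_congr rfl fun k _ => by ring
    have hfirst : |∑ k ∈ Finset.range (n / 2 + 1), w k *
          (c (m + (2 * k : ℤ)) + c (m - (2 * k : ℤ)) - 2 * c m)| ≤ 6 * C * N * q := by
      have hkb : ∀ k ∈ Finset.range (n / 2 + 1), |w k *
          (c (m + (2 * k : ℤ)) + c (m - (2 * k : ℤ)) - 2 * c m)| ≤ 3 * (C * (N / n * q)) := by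
        intro k hk
        have hk2 : 2 * k ≤ n := by have := Finset.mem_range.1 hk; omega
        rw [abs_mul]
        have hwk : |w k| ≤ |2 / (1 - 4 * (k : ℝ) ^ 2)| := by
          rw [hw, abs_mul, abs_of_nonneg (ccDelta_nonneg _ _)]
          exact mul_le_of_le_one_left (abs_nonneg _) (ccDelta_le_one _ _)
        calc _ ≤ |2 / (1 - 4 * (k : ℝ) ^ 2)| * (4 * (k : ℝ) ^ 2 * (C * (N / n * q))) := by
              gcongr; exact hD k hk2
          _ = |2 / (1 - 4 * (k : ℝ) ^ 2)| * (4 * (k : ℝ) ^ 2) * (C * (N / n * q)) := by ring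
          _ ≤ _ := by gcongr; exact abs_two_div_mul_four_mul_sq_le k
      refine (Finset.abs_sum_le_sum_abs _ _).trans ((Finset.sum_le_card_nsmul _ _ _ hkb).trans ?_)
      rw [Finset.card_range, nsmul_eq_mul]
      have hcard : ((n / 2 + 1 : ℕ) : ℝ) ≤ 2 * n := by exact_mod_cast (by omega)
      calc _ ≤ (2 * n : ℝ) * (3 * (C * (N / n * q))) := by gcongr
        _ = _ := by field_simp; ring
    have hw3 : |∑ k ∈ Finset.range (n / 2 + 1), w k| ≤ 3 / (n : ℝ) :=
      abs_sum_ccDelta_two_mul_le hn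
    rw [Real.norm_eq_abs, hsplit]
    refine (abs_add_le _ _).trans ?_
    rw [abs_mul, abs_mul, abs_mul, abs_two, abs_of_nonneg (by norm_num : (0 : ℝ) ≤ 4)]
    calc _ ≤ 2 * (6 * C * N * q) + 4 * (C * (N * n * q)) * (3 / (n : ℝ)) := by gcongr
      _ = _ := by field_simp; norm_num
  have halias : |∑ k ∈ Finset.range (n / 2 + 1), w k * R k| ≤
      24 * C * N * ∑' p : ℕ, ((p : ℝ) + 1) ^ (-s) :=
    hRsum.norm_le_of_bounded (hZ.hasSum.mul_left _) hterm
  -- truncation contribution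
  set y : ℕ → ℝ := fun k => 4 * c (2 * k) / (1 - 4 * (k : ℝ) ^ 2) with hy
  have htailsum := (hasSum_nat_add_iff' (n / 2 + 1)).2 (hasSum_cosCoeff_two_mul hf hsum)
  have htail : |(∫ x in (-1 : ℝ)..1, f x) + 2 * c 0 - ∑ k ∈ Finset.range (n / 2 + 1), y k| ≤
      4 * C * N := by
    obtain ⟨hs1, hs2⟩ := tsum_le_and_summable_one_div (n / 2)
    refine (htailsum.norm_le_of_bounded (hs1.hasSum.mul_left (4 * (C * (N * n))))
      fun k => ?_).trans ?_
    · have hk := hdecay (k + (n / 2 + 1)) (by omega)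
      have hkpos : (1 : ℝ) ≤ (k : ℝ) + (n / 2 : ℕ) + 1 := by
        linarith [(by positivity : (0 : ℝ) ≤ (k : ℝ) + (n / 2 : ℕ))]
      have hden : 0 < 4 * ((k : ℝ) + (n / 2 : ℕ) + 1) ^ 2 - 1 := by nlinarith
      rw [Real.norm_eq_abs, abs_div, abs_mul, abs_of_nonneg (by norm_num : (0 : ℝ) ≤ 4),
        abs_sub_comm, show (((k + (n / 2 + 1) : ℕ)) : ℝ) = (k : ℝ) + (n / 2 : ℕ) + 1 by
          push_cast; ring, abs_of_pos hden, mul_one_div]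
      gcongr
    · calc _ ≤ 4 * (C * (N * n)) * (1 / n) := by
            gcongr
            exact hs2.trans (one_div_two_mul_div_two_add_one_le hn)
        _ = _ := by field_simp
  have hcorr : |if 2 * (n / 2) = n then y (n / 2) / 2 else 0| ≤ 4 * C * N := by
    split_ifs with h
    · have hcast : (n : ℝ) = 2 * ((n / 2 : ℕ) : ℝ) := by exact_mod_cast h.symm
      have e : y (n / 2) / 2 = 2 * c (2 * (n / 2 : ℕ)) * (1 / (1 - (n : ℝ) ^ 2)) := by
        rw [hy, hcast]; ring
      rw [e, abs_mul, abs_mul, abs_two]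
      calc _ ≤ 2 * (C * (N * n)) * (2 / (n : ℝ)) := by
            gcongr
            · exact hdecay (n / 2) (by omega)
            · exact abs_one_div_one_sub_sq_le (by omega)
        _ = _ := by field_simp; ring
    · rw [abs_zero]; positivity
  have herr : ccError f n =
      ((∫ x in (-1 : ℝ)..1, f x) + 2 * c 0 - ∑ k ∈ Finset.range (n / 2 + 1), y k) +
      (if 2 * (n / 2) = n then y (n / 2) / 2 else 0) -
      ∑ k ∈ Finset.range (n / 2 + 1), w k * R k := by
    have hquad : ccQuad f n = ∑ k ∈ Finset.range (n / 2 + 1), ccDelta n (2 * k) * y k +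
        ∑ k ∈ Finset.range (n / 2 + 1), w k * R k := by
      rw [ccQuad_eq_sum_discreteCosCoeff, ← Finset.sum_add_distrib]
      refine Finset.sum_congr rfl fun k _ => ?_
      simp only [hw, hy, hR]
      ring
    have hy0 : y 0 / 2 = 2 * c 0 := by
      simp only [hy]; norm_num; ring
    rw [ccError, hquad, sum_ccDelta_two_mul_mul hn, hy0]
    ring
  rw [herr]
  refine (abs_sub _ _).trans ((add_le_add (abs_add_le _ _) le_rfl).trans ?_)
  exact (add_le_add (add_le_add htail hcorr) halias).trans_eq (by ring)

lemma isBigO_ccError_one_sub_rpow_mul {α : ℝ} (hα : 0 < α) {g : ℝ → ℝ}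
    (hg : ContDiffOn ℝ (⊤ : ℕ∞) g (Set.Icc (-1) 1)) :
    (fun n : ℕ => ccError (fun x => (1 - x) ^ α * g x) n) =O[atTop]
      fun n : ℕ => (n : ℝ) ^ (-2 * α - 2) := by
  have hf : ContinuousOn (fun x => (1 - x) ^ α * g x) (Set.Icc (-1) 1) :=
    (ContinuousOn.rpow_const (by fun_prop) fun _ _ => Or.inr hα.le).mul hg.continuousOn
  obtain ⟨C1, hC10, hC1⟩ := exists_abs_cosCoeff_le hα hg
  obtain ⟨C2, hC20, hC2⟩ := exists_abs_cosCoeff_le (by linarith : 0 < α + 1) hg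
  have hmul (m : ℤ) : cosCoeff (fun x => (1 - x) * ((1 - x) ^ α * g x)) m =
      cosCoeff (fun x => (1 - x) ^ (α + 1) * g x) m := by
    unfold cosCoeff
    congr 2 with t
    beta_reduce
    rw [Real.rpow_add_one' (by linarith [Real.cos_le_one t]) (by linarith)]
    ring
  have h1 (m : ℤ) (hm : m ≠ 0) : |cosCoeff (fun x => (1 - x) ^ α * g x) m| ≤
      (C1 + 2 * C2) * |(m : ℝ)| ^ (-(2 * α + 1)) := by
    refine (hC1 m hm).trans ?_
    rw [show -(2 * α + 1) = -2 * α - 1 by ring]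
    gcongr
    linarith
  have h2 (m : ℤ) (hm : m ≠ 0) : |cosCoeff (fun x => (1 - x) ^ α * g x) (m + 1) +
      cosCoeff (fun x => (1 - x) ^ α * g x) (m - 1) -
      2 * cosCoeff (fun x => (1 - x) ^ α * g x) m| ≤
      (C1 + 2 * C2) * |(m : ℝ)| ^ (-(2 * α + 1) - 2) := by
    rw [cosCoeff_second_diff hf, hmul, abs_mul, abs_neg, abs_two,
      show -(2 * α + 1) - 2 = -2 * (α + 1) - 1 by ring, add_mul, mul_assoc]
    have := hC2 m hm
    have : 0 ≤ C1 * |(m : ℝ)| ^ (-2 * (α + 1) - 1) := by positivity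
    linarith
  obtain ⟨B, hB⟩ := exists_abs_ccError_le hf (by positivity) (by linarith) h1 h2
  refine Asymptotics.IsBigO.of_bound B ?_
  filter_upwards [eventually_ge_atTop 1] with n hn
  rw [Real.norm_of_nonneg (by positivity : (0 : ℝ) ≤ (n : ℝ) ^ (-2 * α - 2)), Real.norm_eq_abs]
  convert hB n hn using 3
  ring

lemma ccWeight_reflect {n j : ℕ} (hj : j ≤ n) : ccWeight n (n - j) = ccWeight n j := by
  rcases Nat.eq_zero_or_pos n with rfl | hn
  · obtain rfl : j = 0 := by omega
    rfl
  have hn0 : (n : ℝ) ≠ 0 := by positivity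
  have hδ : ccDelta n (n - j) = ccDelta n j := by
    unfold ccDelta
    split_ifs <;> first | rfl | omega
  unfold ccWeight
  rw [hδ]
  congr 1
  refine Finset.sum_congr rfl fun k _ => ?_
  rw [Nat.cast_sub hj, show 2 * ((n : ℝ) - j) * k * π / n
    = k * (2 * π) - 2 * (j : ℝ) * k * π / n by field_simp, Real.cos_nat_mul_two_pi_sub]

lemma ccError_comp_neg (f : ℝ → ℝ) {n : ℕ} (hn : 1 ≤ n) :
    ccError (fun x => f (-x)) n = ccError f n := by
  have hn0 : (n : ℝ) ≠ 0 := by positivity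
  have h_int : ∫ x in (-1 : ℝ)..1, f (-x) = ∫ x in (-1 : ℝ)..1, f x := by
    simp
  unfold ccError
  rw [h_int]
  congr 1
  unfold ccQuad
  rw [← Finset.sum_range_reflect]
  refine Finset.sum_congr rfl fun j hj => ?_
  have hj : j ≤ n := by have := Finset.mem_range.1 hj; omega
  rw [show n + 1 - 1 - j = n - j by omega, ccWeight_reflect hj, Nat.cast_sub hj,
    show ((n : ℝ) - j) * π / n = π - j * π / n by field_simp, Real.cos_pi_sub]
  simp only [neg_neg]

/-- For `f(x) = (1−x)^α g(x)` or `f(x) = (1+x)^α g(x)` with `α > 0` not an integer and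
`g` smooth on `[−1,1]`, the Clenshaw–Curtis error satisfies
`E_n^C[f] = O(n^{−2α−2})`. -/
theorem ccError_one_endpoint_singularity (α : ℝ) (hα : 0 < α)
    (hint : ¬(∃ i : ℤ, α = (i : ℝ)))
    (g : ℝ → ℝ) (hg : ContDiffOn ℝ (⊤ : ℕ∞) g (Set.Icc (-1) 1))
    (f : ℝ → ℝ)
    (hf : (∀ x, f x = (1 - x) ^ α * g x) ∨ (∀ x, f x = (1 + x) ^ α * g x)) :
    (fun n : ℕ => ccError f n) =O[atTop] fun n : ℕ => (n : ℝ) ^ (-2 * α - 2) := by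
  rcases hf with hf | hf
  · rw [funext hf]
    exact isBigO_ccError_one_sub_rpow_mul hα hg
  · have hg' : ContDiffOn ℝ (⊤ : ℕ∞) (fun x => g (-x)) (Set.Icc (-1) 1) :=
      hg.comp contDiff_neg.contDiffOn fun x hx => ⟨by linarith [hx.2], by linarith [hx.1]⟩
    refine (isBigO_ccError_one_sub_rpow_mul hα hg').congr' ?_ Filter.EventuallyEq.rfl
    filter_upwards [eventually_ge_atTop 1] with n hn
    rw [← ccError_comp_neg f hn]
    congr 1
    funext x
    rw [hf, ← sub_eq_add_neg]
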